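/- arXiv:1701.05965 — 2 statements merged into one kernel-verified Lean document; each statement's English description precedes it below -/
import Mathlib

section
/- Let m ≥ 4 and let e be an integer with 1 ≤ e ≤ m/2 such that m/gcd(m,e) is odd, and set h = (m − gcd(m,e))/2. Then the dual code C̄_e^⊥ has 𝔽₂-dimension 2m+1, and its weight distribution is: exactly 1 codeword each of weights 0 and 2^m; exactly (2^m−1)·2^{2h} codewords of weight 2^{m−1}−2^{m−1−h}; exactly (2^m−1)·2^{2h} codewords of weight 2^{m−1}+2^{m−1−h}; exactly (2^m−1)(2^{m+1}−2^{2h+1}+2) codewords of weight 2^{m−1}; and no codewords of any other weight. In particular the minimum distance of C̄_e^⊥ is 2^{m−1}−2^{m−1−h}. -/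
noncomputable local instance (m : ℕ) : Fintype (GaloisField 2 m) := Fintype.ofFinite _
attribute [local instance] Classical.propDecidable

/-- `∑_{g∈F} ι(c(g))·g^s ∈ F = GF(2^m)`, where `ι : 𝔽₂ → F` is the unique ring hom. -/
noncomputable def phiF (m s : ℕ) :
    (GaloisField 2 m → ZMod 2) →ₗ[ZMod 2] GaloisField 2 m where
  toFun c := ∑ g, algebraMap (ZMod 2) (GaloisField 2 m) (c g) * g ^ s
  map_add' c d := by simp [add_mul, Finset.sum_add_distrib]
  map_smul' a c := by simp [Algebra.smul_def, mul_assoc, Finset.mul_sum]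

/-- The parity functional `c ↦ ∑_{g∈F} c(g) ∈ 𝔽₂`. -/
noncomputable def parF (m : ℕ) : (GaloisField 2 m → ZMod 2) →ₗ[ZMod 2] ZMod 2 where
  toFun c := ∑ g, c g
  map_add' c d := by simp [Finset.sum_add_distrib]
  map_smul' a c := by simp [Finset.mul_sum]

/-- The extended binary cyclic code `C̄_e` of length `2^m`, with coordinates indexed by
`F = GF(2^m)`: all `c : F → 𝔽₂` with `∑_{g∈F} c(g) = 0` in `𝔽₂`,
`∑_{g∈F} ι(c(g))·g = 0` and `∑_{g∈F} ι(c(g))·g^{2^e+1} = 0` in `F`. -/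
noncomputable def extCode (m e : ℕ) : Submodule (ZMod 2) (GaloisField 2 m → ZMod 2) :=
  LinearMap.ker (parF m) ⊓ LinearMap.ker (phiF m 1) ⊓ LinearMap.ker (phiF m (2 ^ e + 1))

/-- The dual code `C̄_e^⊥`. -/
noncomputable def dualCode (m e : ℕ) : Submodule (ZMod 2) (GaloisField 2 m → ZMod 2) where
  carrier := {y | ∀ c ∈ extCode m e, ∑ g, c g * y g = 0}
  add_mem' := by
    intro a b ha hb c hc
    simp only [Pi.add_apply, mul_add, Finset.sum_add_distrib, ha c hc, hb c hc, add_zero]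
  zero_mem' := by intro c hc; simp
  smul_mem' := by
    intro a y hy c hc
    simp only [Pi.smul_apply, smul_eq_mul, mul_left_comm, ← Finset.mul_sum, hy c hc, mul_zero]

/-- The Hamming weight of a codeword. -/
noncomputable def wt {m : ℕ} (y : GaloisField 2 m → ZMod 2) : ℕ :=
  (Finset.univ.filter fun g => y g ≠ 0).card

/-- The nontrivial additive character `𝔽₂ → {1, -1}`. -/
def signChar (t : ZMod 2) : ℤ := (-1) ^ t.val

lemma signChar_zero : signChar 0 = 1 := rfl

lemma signChar_one : signChar 1 = -1 := rfl

lemma zmod_two_cases (t : ZMod 2) : t = 0 ∨ t = 1 := by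
  fin_cases t
  · exact Or.inl rfl
  · exact Or.inr rfl

lemma signChar_add (s t : ZMod 2) : signChar (s + t) = signChar s * signChar t := by
  fin_cases s <;> fin_cases t <;> rfl

lemma signChar_sq (t : ZMod 2) : signChar t ^ 2 = 1 := by
  fin_cases t <;> rfl

lemma sum_signChar_addMonoidHom {G : Type*} [AddCommGroup G] [Fintype G] (f : G →+ ZMod 2) :
    ∑ x, signChar (f x) = if ∀ x, f x = 0 then (Fintype.card G : ℤ) else 0 := by
  split_ifs with hf
  · simp [hf, signChar_zero]
  · push Not at hf
    obtain ⟨x₀, hx₀⟩ := hf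
    have h1 : f x₀ = 1 := (zmod_two_cases _).resolve_left hx₀
    have h2 := Fintype.sum_equiv (Equiv.addRight x₀) (fun x => signChar (f (x + x₀)))
      (fun x => signChar (f x)) (fun x => rfl)
    simp only [map_add, signChar_add, h1, signChar_one, ← Finset.sum_mul] at h2
    linarith

/-- The squared exponential sum of a function on `G` with additive derivatives: it vanishes or
equals the order of `G` times the order of the radical. -/
lemma sq_sum_signChar_quadratic {G : Type*} [AddCommGroup G] [Fintype G] (q : G → ZMod 2)
    (B : G →+ G →+ ZMod 2) (hq : ∀ x z, q (x + z) = q x + q z + B z x) :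
    (∑ x, signChar (q x)) ^ 2 = 0 ∨
      (∑ x, signChar (q x)) ^ 2 = Fintype.card G * Nat.card B.ker := by
  have key : (∑ x, signChar (q x)) ^ 2 =
      Fintype.card G * ∑ z : B.ker, signChar (q z) := by
    have h1 : (∑ x, signChar (q x)) ^ 2 = ∑ z, signChar (q z) * ∑ x, signChar (B z x) := by
      rw [sq, Finset.sum_mul]
      simp only [Finset.mul_sum]
      have : ∀ x, ∑ y, signChar (q x) * signChar (q y) =
          ∑ z, signChar (q z) * signChar (B z x) := fun x => by
        rw [← Fintype.sum_equiv (Equiv.addLeft x)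
          (fun z => signChar (q x) * signChar (q (x + z))) _ (fun z => rfl)]
        refine Finset.sum_congr rfl fun z _ => ?_
        rw [hq, signChar_add, signChar_add]
        linear_combination signChar (q z) * signChar (B z x) * signChar_sq (q x)
      rw [Finset.sum_congr rfl fun x _ => this x, Finset.sum_comm]
    rw [h1]
    have h2 : ∀ z, ∑ x, signChar (B z x) = if z ∈ B.ker then (Fintype.card G : ℤ) else 0 := by
      intro z
      rw [sum_signChar_addMonoidHom]
      simp [AddMonoidHom.mem_ker, DFunLike.ext_iff]
    simp only [h2, mul_ite, mul_zero]
    rw [← Finset.sum_filter, Finset.mul_sum]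
    rw [← Finset.sum_subtype_eq_sum_filter]
    simp only [Finset.subtype_univ, mul_comm]
  have q0 : q 0 = 0 := by
    have := hq 0 0
    simpa using this
  let f : B.ker →+ ZMod 2 :=
    { toFun := fun z => q z
      map_zero' := by simpa using q0
      map_add' := fun x z => by
        have hz : B z = 0 := z.2
        simp [hq, hz] }
  have hf := sum_signChar_addMonoidHom f
  rw [key]
  change ∑ z : B.ker, signChar (q z) = _ at hf
  rw [hf]
  split_ifs
  · right; simp [Nat.card_eq_fintype_card]
  · left; simp

/-- The number of solutions of `z^(2^n) = z` in the field with `2^m` elements. -/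
lemma card_pow_two_pow_eq_self {F : Type*} [Field F] [Fintype F] {m n : ℕ}
    (hF : Fintype.card F = 2 ^ m) :
    Nat.card {z : F // z ^ 2 ^ n = z} = 2 ^ Nat.gcd m n := by
  have hu : Nat.card Fˣ = 2 ^ m - 1 := by
    rw [Nat.card_units, Nat.card_eq_fintype_card, hF]
  have hk := IsCyclic.card_powMonoidHom_ker Fˣ (2 ^ n - 1)
  rw [hu, Nat.pow_sub_one_gcd_pow_sub_one] at hk
  have hpos : 2 ^ n = (2 ^ n - 1) + 1 := (Nat.sub_add_cancel Nat.one_le_two_pow).symm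
  let ψ : {z : F // z ^ 2 ^ n = z} ≃ Option (powMonoidHom (2 ^ n - 1) : Fˣ →* Fˣ).ker :=
    { toFun := fun z => if hz : z.1 = 0 then none else some ⟨Units.mk0 z.1 hz, by
        have h := z.2
        have h' : z.1 ^ (2 ^ n - 1) * z.1 = 1 * z.1 := by rw [← pow_succ, ← hpos, h, one_mul]
        rw [MonoidHom.mem_ker]
        ext
        simpa using mul_right_cancel₀ hz h'⟩
      invFun := fun o => o.elim ⟨0, by simp⟩ fun u => ⟨(u.1 : F), by
        have h := u.2
        rw [MonoidHom.mem_ker, powMonoidHom_apply] at h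
        have h' : (u.1 : F) ^ (2 ^ n - 1 + 1) = u.1 := by
          rw [pow_succ, ← Units.val_pow_eq_pow_val, h]
          simp
        rwa [← hpos] at h'⟩
      left_inv := fun z => by
        by_cases hz : z.1 = 0
        · simp only [hz, dite_true, Option.elim]
          exact Subtype.ext hz.symm
        · simp [hz]
      right_inv := fun o => by
        cases o <;> simp }
  rw [Nat.card_congr ψ, Finite.card_option, hk, Nat.sub_add_cancel Nat.one_le_two_pow]

lemma exists_pow_two_pow_add_one_eq {F : Type*} [Field F] [Fintype F] {m e : ℕ}
    (hF : Fintype.card F = 2 ^ m)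
    (hg : Nat.gcd m (2 * e) = Nat.gcd m e) (hm : m ≠ 0) {a : F} (ha : a ≠ 0) :
    ∃ β : F, β ≠ 0 ∧ β ^ (2 ^ e + 1) = a := by
  have hc : Nat.Coprime (2 ^ m - 1) (2 ^ e + 1) := by
    have h1 : Nat.gcd (2 ^ m - 1) (2 ^ e + 1) ∣ 2 ^ e - 1 := by
      have h2 : Nat.gcd (2 ^ m - 1) (2 ^ e + 1) ∣ Nat.gcd (2 ^ m - 1) (2 ^ (2 * e) - 1) := by
        refine Nat.gcd_dvd_gcd_of_dvd_right _ ⟨2 ^ e - 1, ?_⟩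
        rw [mul_comm 2 e, pow_mul, ← Nat.sq_sub_sq, one_pow]
      rw [Nat.pow_sub_one_gcd_pow_sub_one, hg, ← Nat.pow_sub_one_gcd_pow_sub_one] at h2
      exact h2.trans (Nat.gcd_dvd_right _ _)
    have h3 : Nat.gcd (2 ^ m - 1) (2 ^ e + 1) ∣ 2 := by
      have h4 : 2 = (2 ^ e + 1) - (2 ^ e - 1) := by
        have : 1 ≤ 2 ^ e := Nat.one_le_two_pow
        omega
      have h5 := Nat.dvd_sub (Nat.gcd_dvd_right (2 ^ m - 1) (2 ^ e + 1)) h1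
      rwa [← h4] at h5
    rcases (Nat.dvd_prime Nat.prime_two).mp h3 with h | h
    · exact h
    · have h5 : 2 ∣ 2 ^ m - 1 := by
        have := Nat.gcd_dvd_left (2 ^ m - 1) (2 ^ e + 1)
        rwa [h] at this
      have h6 : 2 ∣ 2 ^ m := dvd_pow_self 2 hm
      have : 1 ≤ 2 ^ m := Nat.one_le_two_pow
      omega
  have hu : Nat.card Fˣ = 2 ^ m - 1 := by
    rw [Nat.card_units, Nat.card_eq_fintype_card, hF]
  rw [← hu] at hc
  obtain ⟨β, hβ⟩ := (powCoprime hc).surjective (Units.mk0 a ha)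
  refine ⟨β, β.ne_zero, ?_⟩
  simpa using congrArg Units.val hβ

section FiniteField

variable {F : Type*} [Field F] [Fintype F] [Algebra (ZMod 2) F]

local notation "Tr" => Algebra.trace (ZMod 2) F

lemma trace_zmod_two_nondegenerate {a : F} (h : ∀ x, Tr (a * x) = 0) : a = 0 := by
  have := (traceForm_nondegenerate (ZMod 2) F).1 a
  exact this fun x => h x

lemma trace_pow_two_pow (n : ℕ) (x : F) : Tr (x ^ 2 ^ n) = Tr x := by
  induction n with
  | zero => simp
  | succ n ih =>
    rw [pow_succ, pow_mul, ← ih]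
    have := Algebra.trace_eq_of_algEquiv
      (FiniteField.frobeniusAlgEquivOfAlgebraic (ZMod 2) F) (x ^ 2 ^ n)
    simpa [FiniteField.coe_frobeniusAlgEquivOfAlgebraic, ZMod.card] using this

/-- The exponential sum of `x ↦ Tr (a x^(2^e+1) + b x)`. -/
noncomputable def goldSum (e : ℕ) (a b : F) : ℤ :=
  ∑ x : F, signChar (Tr (a * x ^ (2 ^ e + 1)) + Tr (b * x))

lemma sum_signChar_trace_mul (b : F) :
    ∑ x : F, signChar (Tr (b * x)) = if b = 0 then (Fintype.card F : ℤ) else 0 := by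
  have := sum_signChar_addMonoidHom
    ((Algebra.trace (ZMod 2) F).toAddMonoidHom.comp (AddMonoidHom.mulLeft b))
  simp only [AddMonoidHom.comp_apply, AddMonoidHom.coe_mulLeft, LinearMap.toAddMonoidHom_coe]
    at this
  rw [this]
  congr 1
  exact propext ⟨trace_zmod_two_nondegenerate, fun h => by simp [h]⟩

lemma goldSum_zero_left (e : ℕ) (b : F) :
    goldSum e 0 b = if b = 0 then (Fintype.card F : ℤ) else 0 := by
  simp [goldSum, ← sum_signChar_trace_mul]

/-- Parseval's identity. -/
lemma sum_sq_goldSum (e : ℕ) (a : F) :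
    ∑ b : F, goldSum e a b ^ 2 = (Fintype.card F : ℤ) ^ 2 := by
  have : CharP F 2 := charP_of_injective_algebraMap (algebraMap (ZMod 2) F).injective 2
  simp only [goldSum, sq, Finset.sum_mul_sum]
  rw [Finset.sum_comm]
  have : ∀ x : F, ∑ b : F, ∑ y : F,
      signChar (Tr (a * x ^ (2 ^ e + 1)) + Tr (b * x)) *
      signChar (Tr (a * y ^ (2 ^ e + 1)) + Tr (b * y)) = Fintype.card F := by
    intro x
    rw [Finset.sum_comm]
    have h : ∀ y : F, ∑ b : F, signChar (Tr (a * x ^ (2 ^ e + 1)) + Tr (b * x)) *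
        signChar (Tr (a * y ^ (2 ^ e + 1)) + Tr (b * y)) =
        if y = x then (Fintype.card F : ℤ) else 0 := by
      intro y
      have : ∀ b : F, signChar (Tr (a * x ^ (2 ^ e + 1)) + Tr (b * x)) *
        signChar (Tr (a * y ^ (2 ^ e + 1)) + Tr (b * y)) =
        signChar (Tr (a * x ^ (2 ^ e + 1))) * signChar (Tr (a * y ^ (2 ^ e + 1))) *
          signChar (Tr ((x + y) * b)) := by
        intro b
        rw [mul_comm (x + y), mul_add, map_add]
        simp only [signChar_add]
        ring
      rw [Finset.sum_congr rfl fun b _ => this b, ← Finset.mul_sum, sum_signChar_trace_mul]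
      by_cases hxy : y = x
      · subst hxy
        simp [CharTwo.add_self_eq_zero, ← sq, signChar_sq]
      · have : x + y ≠ 0 := fun h => hxy (CharTwo.add_eq_zero.mp h).symm
        simp [hxy, this]
    rw [Finset.sum_congr rfl fun y _ => h y]
    simp
  rw [Finset.sum_congr rfl fun x _ => this x]
  simp

/-- The polar form of `x ↦ Tr (x^(2^e+1))`. -/
noncomputable def goldPolar (F : Type*) [Field F] [Fintype F] [Algebra (ZMod 2) F] (e : ℕ) :
    F →+ F →+ ZMod 2 :=
  haveI : CharP F 2 := charP_of_injective_algebraMap (algebraMap (ZMod 2) F).injective 2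
  AddMonoidHom.mk' (fun z => AddMonoidHom.mk'
    (fun x => Algebra.trace (ZMod 2) F (x ^ 2 ^ e * z + x * z ^ 2 ^ e))
    (fun x y => by rw [← map_add, add_pow_char_pow]; ring_nf))
    (fun z w => by
      ext x
      simp only [AddMonoidHom.mk'_apply, AddMonoidHom.add_apply]
      rw [← map_add, add_pow_char_pow]; ring_nf)

lemma mem_ker_goldPolar (e : ℕ) (z : F) :
    z ∈ (goldPolar F e).ker ↔ z ^ 2 ^ (2 * e) = z := by
  have : CharP F 2 := charP_of_injective_algebraMap (algebraMap (ZMod 2) F).injective 2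
  have h1 : ∀ x, goldPolar F e z x = Tr ((z + z ^ 2 ^ (2 * e)) * x ^ 2 ^ e) := by
    intro x
    change Tr (x ^ 2 ^ e * z + x * z ^ 2 ^ e) = _
    rw [map_add, ← trace_pow_two_pow e (x * z ^ 2 ^ e), ← map_add, mul_pow, ← pow_mul, ← pow_add,
      ← two_mul]
    ring_nf
  rw [AddMonoidHom.mem_ker, DFunLike.ext_iff]
  simp only [h1, AddMonoidHom.zero_apply]
  constructor
  · intro h
    have hz : z + z ^ 2 ^ (2 * e) = 0 := trace_zmod_two_nondegenerate fun y => by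
      obtain ⟨x, rfl⟩ := (Finite.injective_iff_surjective.mp
        (iterateFrobenius F 2 e).injective) y
      exact h x
    exact (CharTwo.add_eq_zero.mp hz).symm
  · intro h x
    rw [h, CharTwo.add_self_eq_zero]
    simp

lemma sq_goldSum {m e : ℕ} (hF : Fintype.card F = 2 ^ m) (hm : m ≠ 0)
    (hg : Nat.gcd m (2 * e) = Nat.gcd m e) {a : F} (ha : a ≠ 0) (b : F) :
    goldSum e a b ^ 2 = 0 ∨ goldSum e a b ^ 2 = 2 ^ (m + Nat.gcd m e) := by
  have : CharP F 2 := charP_of_injective_algebraMap (algebraMap (ZMod 2) F).injective 2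
  obtain ⟨β, hβ, rfl⟩ := exists_pow_two_pow_add_one_eq hF hg hm ha
  have h1 : goldSum e (β ^ (2 ^ e + 1)) b =
      ∑ x : F, signChar (Tr (x ^ (2 ^ e + 1)) + Tr (b * β⁻¹ * x)) := by
    refine Fintype.sum_equiv (Equiv.mulLeft₀ β hβ) _ _ fun x => ?_
    simp only [Equiv.mulLeft₀_apply, mul_pow]
    congr 3
    field_simp
  have hcard : Nat.card (goldPolar F e).ker = 2 ^ Nat.gcd m e := by
    rw [← hg, ← card_pow_two_pow_eq_self hF]
    exact Nat.card_congr (Equiv.subtypeEquivRight (mem_ker_goldPolar e))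
  have := sq_sum_signChar_quadratic (fun x : F => Tr (x ^ (2 ^ e + 1)) + Tr (b * β⁻¹ * x))
    (goldPolar F e) (fun x z => by
      change _ = _ + Tr (x ^ 2 ^ e * z + x * z ^ 2 ^ e)
      simp only [pow_succ, add_pow_char_pow, mul_add, add_mul, map_add]
      rw [mul_comm (z ^ 2 ^ e) x]
      ring)
  rw [hcard, hF] at this
  rw [h1, pow_add]
  exact_mod_cast this

lemma card_goldSum_ne_zero {m e : ℕ} (hF : Fintype.card F = 2 ^ m) (hm : m ≠ 0)
    (hg : Nat.gcd m (2 * e) = Nat.gcd m e) {a : F} (ha : a ≠ 0) :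
    (Finset.univ.filter fun b : F => goldSum e a b ≠ 0).card = 2 ^ (m - Nat.gcd m e) := by
  have h1 := sum_sq_goldSum e a
  have h2 : ∀ b : F, goldSum e a b ^ 2 =
      if goldSum e a b ≠ 0 then 2 ^ (m + Nat.gcd m e) else 0 := by
    intro b
    by_cases hb : goldSum e a b = 0
    · simp [hb]
    · rcases sq_goldSum hF hm hg ha b with h | h
      · exact absurd (pow_eq_zero_iff two_ne_zero |>.mp h) hb
      · simp [hb, h]
  rw [Finset.sum_congr rfl fun b _ => h2 b, ← Finset.sum_filter, Finset.sum_const, hF,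
    nsmul_eq_mul] at h1
  have hle : Nat.gcd m e ≤ m := Nat.gcd_le_left _ (Nat.pos_of_ne_zero hm)
  have h3 : (2 ^ m) ^ 2 = 2 ^ (m - Nat.gcd m e) * 2 ^ (m + Nat.gcd m e) := by
    rw [← pow_mul, ← pow_add]
    congr 1
    omega
  have h4 : (Finset.univ.filter fun b : F => goldSum e a b ≠ 0).card * 2 ^ (m + Nat.gcd m e) =
      2 ^ (m - Nat.gcd m e) * 2 ^ (m + Nat.gcd m e) := by
    rw [← h3]
    exact_mod_cast h1
  exact Nat.eq_of_mul_eq_mul_right (by positivity) h4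

end FiniteField

/-- The word `g ↦ Tr (a g^(2^e+1)) + Tr (b g) + c`. -/
noncomputable def goldWord (m e : ℕ) :
    (GaloisField 2 m × GaloisField 2 m × ZMod 2) →ₗ[ZMod 2] (GaloisField 2 m → ZMod 2) where
  toFun p g := Algebra.trace (ZMod 2) (GaloisField 2 m) (p.1 * g ^ (2 ^ e + 1)) +
    Algebra.trace (ZMod 2) (GaloisField 2 m) (p.2.1 * g) + p.2.2
  map_add' p q := by
    ext g
    simp only [Prod.fst_add, Prod.snd_add, add_mul, map_add, Pi.add_apply]
    ring
  map_smul' r p := by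
    ext g
    simp [mul_add]

lemma goldWord_apply (m e : ℕ) (p : GaloisField 2 m × GaloisField 2 m × ZMod 2)
    (g : GaloisField 2 m) :
    goldWord m e p g = Algebra.trace (ZMod 2) (GaloisField 2 m) (p.1 * g ^ (2 ^ e + 1)) +
      Algebra.trace (ZMod 2) (GaloisField 2 m) (p.2.1 * g) + p.2.2 :=
  rfl

lemma sum_mul_trace (m s : ℕ) (c : GaloisField 2 m → ZMod 2) (a : GaloisField 2 m) :
    ∑ g, c g * Algebra.trace (ZMod 2) (GaloisField 2 m) (a * g ^ s) =
      Algebra.trace (ZMod 2) (GaloisField 2 m) (a * phiF m s c) := by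
  change _ = Algebra.trace (ZMod 2) (GaloisField 2 m)
    (a * ∑ g, algebraMap (ZMod 2) (GaloisField 2 m) (c g) * g ^ s)
  rw [Finset.mul_sum, map_sum]
  refine Finset.sum_congr rfl fun g _ => ?_
  rw [mul_left_comm, ← Algebra.smul_def, map_smul, smul_eq_mul]

lemma sum_mul_goldWord (m e : ℕ) (c : GaloisField 2 m → ZMod 2)
    (p : GaloisField 2 m × GaloisField 2 m × ZMod 2) :
    ∑ g, c g * goldWord m e p g =
      Algebra.trace (ZMod 2) (GaloisField 2 m) (p.1 * phiF m (2 ^ e + 1) c) +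
      Algebra.trace (ZMod 2) (GaloisField 2 m) (p.2.1 * phiF m 1 c) + parF m c * p.2.2 := by
  rw [← sum_mul_trace, ← sum_mul_trace]
  change _ = _ + _ + (∑ g, c g) * p.2.2
  simp only [goldWord_apply, mul_add, Finset.sum_add_distrib, Finset.sum_mul, pow_one]

lemma mem_extCode_iff (m e : ℕ) (c : GaloisField 2 m → ZMod 2) :
    c ∈ extCode m e ↔ ∀ p, ∑ g, c g * goldWord m e p g = 0 := by
  simp only [extCode, Submodule.mem_inf, LinearMap.mem_ker, sum_mul_goldWord]
  constructor
  · rintro ⟨⟨h1, h2⟩, h3⟩ p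
    simp [h1, h2, h3]
  · intro h
    refine ⟨⟨?_, ?_⟩, ?_⟩
    · simpa using h (0, 0, 1)
    · exact trace_zmod_two_nondegenerate fun x => by simpa [mul_comm] using h (0, x, 0)
    · exact trace_zmod_two_nondegenerate fun x => by simpa [mul_comm] using h (x, 0, 0)

/-- Delsarte's theorem for the code at hand: the dual code is a trace code. -/
lemma dualCode_eq_range (m e : ℕ) : dualCode m e = LinearMap.range (goldWord m e) := by
  apply le_antisymm
  · intro y hy
    by_contra hyr
    obtain ⟨f, hfy, hf⟩ := Submodule.exists_le_ker_of_notMem hyr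
    have hfs : ∀ v, f v = ∑ g, f (Pi.single g 1) * v g := by
      intro v
      conv_lhs => rw [pi_eq_sum_univ' v]
      rw [map_sum]
      refine Finset.sum_congr rfl fun g _ => ?_
      rw [map_smul, smul_eq_mul, mul_comm]
    apply hfy
    rw [hfs]
    refine hy _ ((mem_extCode_iff m e _).mpr fun p => ?_)
    rw [← hfs]
    exact hf (LinearMap.mem_range_self _ p)
  · rintro _ ⟨p, rfl⟩ c hc
    exact (mem_extCode_iff m e c).mp hc p

lemma card_galoisField_two {m : ℕ} (hm : m ≠ 0) : Fintype.card (GaloisField 2 m) = 2 ^ m := by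
  rw [← Nat.card_eq_fintype_card, GaloisField.card 2 m hm]

lemma sum_signChar_eq_sub_wt {m : ℕ} (hm : m ≠ 0) (y : GaloisField 2 m → ZMod 2) :
    ∑ g, signChar (y g) = 2 ^ m - 2 * (wt y : ℤ) := by
  have h1 : ∀ g, signChar (y g) = 1 - 2 * if y g ≠ 0 then 1 else 0 := by
    intro g
    rcases zmod_two_cases (y g) with h | h <;> simp [h, signChar_zero, signChar_one]
  rw [Finset.sum_congr rfl fun g _ => h1 g, Finset.sum_sub_distrib, ← Finset.mul_sum,
    Finset.sum_boole, Finset.sum_const, Finset.card_univ, card_galoisField_two hm]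
  simp [wt]

lemma sum_signChar_goldWord (m e : ℕ) (p : GaloisField 2 m × GaloisField 2 m × ZMod 2) :
    ∑ g, signChar (goldWord m e p g) = signChar p.2.2 * goldSum e p.1 p.2.1 := by
  simp only [goldWord_apply, goldSum, Finset.mul_sum]
  exact Finset.sum_congr rfl fun g _ => by rw [signChar_add _ p.2.2, mul_comm]

lemma goldWord_wt {m : ℕ} (hm : m ≠ 0) (e : ℕ)
    (p : GaloisField 2 m × GaloisField 2 m × ZMod 2) :
    2 ^ m - 2 * (wt (goldWord m e p) : ℤ) = signChar p.2.2 * goldSum e p.1 p.2.1 := by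
  rw [← sum_signChar_goldWord, sum_signChar_eq_sub_wt hm]

/-- Counting parameter triples with a prescribed value of the signed exponential sum, when the
count over `b` and `c` is the same for all nonzero `a`. -/
lemma card_signChar_mul_goldSum_eq {m : ℕ} (hm : m ≠ 0) (e : ℕ) (t : ℤ) (A B : ℕ)
    (hA : ∑ b : GaloisField 2 m, ((if goldSum e 0 b = t then 1 else 0) +
      if -goldSum e 0 b = t then 1 else 0) = A)
    (hB : ∀ a : GaloisField 2 m, a ≠ 0 → ∑ b : GaloisField 2 m,
      ((if goldSum e a b = t then 1 else 0) + if -goldSum e a b = t then 1 else 0) = B) :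
    Nat.card {p : GaloisField 2 m × GaloisField 2 m × ZMod 2 //
      signChar p.2.2 * goldSum e p.1 p.2.1 = t} = A + (2 ^ m - 1) * B := by
  rw [Nat.card_eq_fintype_card, Fintype.card_subtype, Finset.card_filter, Fintype.sum_prod_type]
  have h1 : ∀ a : GaloisField 2 m, (∑ q : GaloisField 2 m × ZMod 2,
      if signChar q.2 * goldSum e a q.1 = t then 1 else 0) =
      ∑ b : GaloisField 2 m, ((if goldSum e a b = t then 1 else 0) +
        if -goldSum e a b = t then 1 else 0) := by
    intro a
    rw [Fintype.sum_prod_type]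
    refine Finset.sum_congr rfl fun b _ => ?_
    have h2 : ∀ f : ZMod 2 → ℕ, ∑ c, f c = f 0 + f 1 := Fin.sum_univ_two
    rw [h2]
    simp [signChar_zero, signChar_one]
  rw [Finset.sum_congr rfl fun a _ => h1 a, ← Finset.add_sum_erase _ _ (Finset.mem_univ 0), hA,
    Finset.sum_congr rfl fun a ha => hB a (Finset.ne_of_mem_erase ha), Finset.sum_const,
    Finset.card_erase_of_mem (Finset.mem_univ _), Finset.card_univ, card_galoisField_two hm,
    smul_eq_mul]

lemma sum_ite_goldSum_zero_left {m : ℕ} (hm : m ≠ 0) (e : ℕ) (t : ℤ) :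
    ∑ b : GaloisField 2 m, ((if goldSum e 0 b = t then 1 else 0) +
      if -goldSum e 0 b = t then 1 else 0) =
    ((if (2 ^ m : ℤ) = t then 1 else 0) + if (-2 ^ m : ℤ) = t then 1 else 0) +
      (2 ^ m - 1) * (2 * if t = 0 then 1 else 0) := by
  rw [← Finset.add_sum_erase _ _ (Finset.mem_univ 0)]
  congr 1
  · simp [goldSum_zero_left, card_galoisField_two hm]
  · rw [Finset.sum_congr rfl fun b hb => by
      rw [goldSum_zero_left, if_neg (Finset.ne_of_mem_erase hb), neg_zero, ← two_mul],
      Finset.sum_const, Finset.card_erase_of_mem (Finset.mem_univ _), Finset.card_univ,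
      card_galoisField_two hm, smul_eq_mul]
    simp only [eq_comm]

section OddCase

variable {m e h : ℕ}

lemma gcd_two_mul_right_of_odd_div (hm : m ≠ 0) (hodd : Odd (m / Nat.gcd m e)) :
    Nat.gcd m (2 * e) = Nat.gcd m e := by
  have hd : 0 < Nat.gcd m e := Nat.gcd_pos_of_pos_left _ (Nat.pos_of_ne_zero hm)
  have hc : Nat.Coprime (m / Nat.gcd m e) (e / Nat.gcd m e) := Nat.coprime_div_gcd_div_gcd hd
  have h2 : Nat.Coprime (m / Nat.gcd m e) 2 := Nat.coprime_two_right.mpr hodd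
  have h3 := Nat.Coprime.mul_right h2 hc
  have h4 := Nat.gcd_mul_left (Nat.gcd m e) (m / Nat.gcd m e) (2 * (e / Nat.gcd m e))
  rwa [h3, mul_one, mul_left_comm, Nat.mul_div_cancel' (Nat.gcd_dvd_left m e),
    Nat.mul_div_cancel' (Nat.gcd_dvd_right m e)] at h4

lemma two_mul_add_gcd_eq (he1 : 1 ≤ e) (he2 : 2 * e ≤ m) (hodd : Odd (m / Nat.gcd m e))
    (hh : h = (m - Nat.gcd m e) / 2) : 1 ≤ h ∧ 2 * h + Nat.gcd m e = m := by
  obtain ⟨k, hk⟩ := hodd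
  have h1 := Nat.mul_div_cancel' (Nat.gcd_dvd_left m e)
  have h2 : Nat.gcd m e ≤ e := Nat.gcd_le_right _ he1
  have h3 : m = 2 * (Nat.gcd m e * k) + Nat.gcd m e := by
    rw [hk] at h1
    linarith
  omega

lemma goldSum_values (hm : m ≠ 0) (hg : Nat.gcd m (2 * e) = Nat.gcd m e)
    (h2 : 2 * h + Nat.gcd m e = m) {a : GaloisField 2 m} (ha : a ≠ 0) (b : GaloisField 2 m) :
    goldSum e a b = 0 ∨ goldSum e a b = 2 ^ (m - h) ∨ goldSum e a b = -2 ^ (m - h) := by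
  have h3 : (2 : ℤ) ^ (m + Nat.gcd m e) = (2 ^ (m - h)) ^ 2 := by
    rw [← pow_mul]
    congr 1
    omega
  rcases sq_goldSum (card_galoisField_two hm) hm hg ha b with h | h
  · exact Or.inl (pow_eq_zero_iff two_ne_zero |>.mp h)
  · exact Or.inr (sq_eq_sq_iff_eq_or_eq_neg.mp (h.trans h3))

lemma goldWord_injective (hm : m ≠ 0) (hg : Nat.gcd m (2 * e) = Nat.gcd m e)
    (h1 : 1 ≤ h) (h2 : 2 * h + Nat.gcd m e = m) : Function.Injective (goldWord m e) := by
  rw [injective_iff_map_eq_zero]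
  intro p hp
  obtain ⟨a, b, c⟩ := p
  have h3 := goldWord_wt hm e (a, b, c)
  have h4 : (2 : ℤ) ^ (m - h) < 2 ^ m := pow_lt_pow_right₀ (by norm_num) (by omega)
  have h5 : (0 : ℤ) < 2 ^ (m - h) := by positivity
  simp only [hp, wt, Pi.zero_apply, ne_eq, not_true_eq_false, Finset.filter_false,
    Finset.card_empty, Nat.cast_zero, mul_zero, sub_zero] at h3
  have ha : a = 0 := by
    by_contra ha
    rcases zmod_two_cases c with rfl | rfl <;>
    rcases goldSum_values hm hg h2 ha b with h | h | h <;>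
    simp only [h, signChar_zero, signChar_one] at h3 <;> linarith
  subst ha
  have hb : b = 0 := by
    by_contra hb
    rw [goldSum_zero_left, if_neg hb] at h3
    linarith
  subst hb
  have hc := congrFun hp 0
  simp only [goldWord_apply] at hc
  simpa using hc

lemma card_dualCode_wt_eq (hm : m ≠ 0) (hinj : Function.Injective (goldWord m e)) {w : ℕ} {t : ℤ}
    (ht : t = 2 ^ m - 2 * w) :
    Nat.card {y : GaloisField 2 m → ZMod 2 // y ∈ dualCode m e ∧ wt y = w} =
    Nat.card {p : GaloisField 2 m × GaloisField 2 m × ZMod 2 //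
      signChar p.2.2 * goldSum e p.1 p.2.1 = t} := by
  have hiff : ∀ p, wt (goldWord m e p) = w ↔ signChar p.2.2 * goldSum e p.1 p.2.1 = t := by
    intro p
    have := goldWord_wt hm e p
    omega
  symm
  refine Nat.card_congr (Equiv.ofBijective
    (fun p => ⟨goldWord m e p.1, dualCode_eq_range m e ▸ LinearMap.mem_range_self _ p.1,
      (hiff p.1).mpr p.2⟩) ⟨fun p q hpq => Subtype.ext (hinj (congrArg Subtype.val hpq)), ?_⟩)
  rintro ⟨y, hy, hw⟩
  rw [dualCode_eq_range] at hy
  obtain ⟨p, rfl⟩ := hy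
  exact ⟨⟨p, (hiff p).mp hw⟩, rfl⟩

lemma card_goldSum_eq_zero (hm : m ≠ 0) (hg : Nat.gcd m (2 * e) = Nat.gcd m e)
    (h2 : 2 * h + Nat.gcd m e = m) {a : GaloisField 2 m} (ha : a ≠ 0) :
    (Finset.univ.filter fun b => goldSum e a b = 0).card = 2 ^ m - 2 ^ (2 * h) := by
  have h3 := card_goldSum_ne_zero (card_galoisField_two hm) hm hg ha
  have h4 := Finset.card_filter_add_card_filter_not (s := Finset.univ)
    (fun b => goldSum e a b = 0)
  rw [Finset.card_univ, card_galoisField_two hm] at h4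
  rw [show m - Nat.gcd m e = 2 * h by omega] at h3
  simp only [ne_eq] at h3
  omega

/-- Both signs `ε = ±1` are handled at once. -/
lemma card_signChar_mul_goldSum_eq_pow (hm : m ≠ 0) (hg : Nat.gcd m (2 * e) = Nat.gcd m e)
    (h1 : 1 ≤ h) (h2 : 2 * h + Nat.gcd m e = m) {t : ℤ}
    (ht : t = 2 ^ (m - h) ∨ t = -2 ^ (m - h)) :
    Nat.card {p : GaloisField 2 m × GaloisField 2 m × ZMod 2 //
      signChar p.2.2 * goldSum e p.1 p.2.1 = t} = (2 ^ m - 1) * 2 ^ (2 * h) := by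
  have h4 : (2 : ℤ) ^ (m - h) < 2 ^ m := pow_lt_pow_right₀ (by norm_num) (by omega)
  have h5 : (0 : ℤ) < 2 ^ (m - h) := by positivity
  rw [card_signChar_mul_goldSum_eq hm e t 0 (2 ^ (2 * h)), zero_add]
  · rw [sum_ite_goldSum_zero_left hm, if_neg (by rcases ht with rfl | rfl <;> linarith),
      if_neg (by rcases ht with rfl | rfl <;> linarith),
      if_neg (by rcases ht with rfl | rfl <;> linarith)]
    simp
  · intro a ha
    have h3 := card_goldSum_ne_zero (card_galoisField_two hm) hm hg ha
    rw [show m - Nat.gcd m e = 2 * h by omega, Finset.card_filter] at h3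
    rw [← h3]
    refine Finset.sum_congr rfl fun b _ => ?_
    have hn : (2 : ℤ) ^ (m - h) ≠ -2 ^ (m - h) := by linarith
    have hn' : -(2 : ℤ) ^ (m - h) ≠ 2 ^ (m - h) := by linarith
    rcases goldSum_values hm hg h2 ha b with h | h | h <;> rcases ht with rfl | rfl <;>
      simp [h, hn, hn', h5.ne, h5.ne']

lemma card_signChar_mul_goldSum_eq_card (hm : m ≠ 0) (hg : Nat.gcd m (2 * e) = Nat.gcd m e)
    (h1 : 1 ≤ h) (h2 : 2 * h + Nat.gcd m e = m) {t : ℤ} (ht : t = 2 ^ m ∨ t = -2 ^ m) :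
    Nat.card {p : GaloisField 2 m × GaloisField 2 m × ZMod 2 //
      signChar p.2.2 * goldSum e p.1 p.2.1 = t} = 1 := by
  have h4 : (2 : ℤ) ^ (m - h) < 2 ^ m := pow_lt_pow_right₀ (by norm_num) (by omega)
  have h5 : (0 : ℤ) < 2 ^ (m - h) := by positivity
  rw [card_signChar_mul_goldSum_eq hm e t 1 0, mul_zero, add_zero]
  · have hn : (2 : ℤ) ^ m ≠ -2 ^ m := by linarith
    have hn' : -(2 : ℤ) ^ m ≠ 2 ^ m := by linarith
    rw [sum_ite_goldSum_zero_left hm]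
    rcases ht with rfl | rfl <;> simp [hn, hn']
  · intro a ha
    refine Finset.sum_eq_zero fun b _ => ?_
    have : goldSum e a b ≠ t ∧ -goldSum e a b ≠ t := by
      rcases goldSum_values hm hg h2 ha b with h | h | h <;> rcases ht with rfl | rfl <;>
        rw [h] <;> constructor <;> linarith
    simp [this.1, this.2]

lemma card_signChar_mul_goldSum_eq_zero (hm : m ≠ 0) (hg : Nat.gcd m (2 * e) = Nat.gcd m e)
    (h2 : 2 * h + Nat.gcd m e = m) :
    Nat.card {p : GaloisField 2 m × GaloisField 2 m × ZMod 2 //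
      signChar p.2.2 * goldSum e p.1 p.2.1 = 0} =
    (2 ^ m - 1) * (2 ^ (m + 1) - 2 ^ (2 * h + 1) + 2) := by
  rw [card_signChar_mul_goldSum_eq hm e 0 ((2 ^ m - 1) * 2) (2 * (2 ^ m - 2 ^ (2 * h))),
    ← mul_add]
  · congr 1
    rw [pow_succ, pow_succ]
    omega
  · rw [sum_ite_goldSum_zero_left hm]
    simp
  · intro a ha
    rw [← card_goldSum_eq_zero hm hg h2 ha, Finset.card_filter, Finset.mul_sum]
    refine Finset.sum_congr rfl fun b _ => ?_
    rw [two_mul]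
    simp only [neg_eq_zero]

end OddCase

/-- When `m/gcd(m,e)` is odd and `h = (m - gcd(m,e))/2`, the dual `C̄_e^⊥` has
dimension `2m+1`, weight distribution as in Table IV, and minimum distance
`2^{m-1} - 2^{m-1-h}`. -/
theorem dualCode_weight_distribution_odd_case (m e : ℕ) (hm : 4 ≤ m)
    (he1 : 1 ≤ e) (he2 : 2 * e ≤ m) (hodd : Odd (m / Nat.gcd m e))
    (h : ℕ) (hh : h = (m - Nat.gcd m e) / 2) :
    Module.finrank (ZMod 2) (dualCode m e) = 2 * m + 1 ∧
    Nat.card {y : GaloisField 2 m → ZMod 2 // y ∈ dualCode m e ∧ wt y = 0} = 1 ∧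
    Nat.card {y : GaloisField 2 m → ZMod 2 // y ∈ dualCode m e ∧ wt y = 2 ^ m} = 1 ∧
    Nat.card {y : GaloisField 2 m → ZMod 2 // y ∈ dualCode m e ∧
        wt y = 2 ^ (m - 1) - 2 ^ (m - 1 - h)} = (2 ^ m - 1) * 2 ^ (2 * h) ∧
    Nat.card {y : GaloisField 2 m → ZMod 2 // y ∈ dualCode m e ∧
        wt y = 2 ^ (m - 1) + 2 ^ (m - 1 - h)} = (2 ^ m - 1) * 2 ^ (2 * h) ∧
    Nat.card {y : GaloisField 2 m → ZMod 2 // y ∈ dualCode m e ∧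
        wt y = 2 ^ (m - 1)} = (2 ^ m - 1) * (2 ^ (m + 1) - 2 ^ (2 * h + 1) + 2) ∧
    (∀ y ∈ dualCode m e, wt y ∈ ({0, 2 ^ (m - 1) - 2 ^ (m - 1 - h), 2 ^ (m - 1),
        2 ^ (m - 1) + 2 ^ (m - 1 - h), 2 ^ m} : Set ℕ)) ∧
    IsLeast {w : ℕ | ∃ y ∈ dualCode m e, y ≠ 0 ∧ wt y = w}
      (2 ^ (m - 1) - 2 ^ (m - 1 - h)) := by
  have hm0 : m ≠ 0 := by omega
  have hg := gcd_two_mul_right_of_odd_div hm0 hodd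
  obtain ⟨h1, h2⟩ := two_mul_add_gcd_eq he1 he2 hodd hh
  have hinj := goldWord_injective hm0 hg h1 h2
  have e1 : (2 : ℕ) ^ m = 2 * 2 ^ (m - 1) := by rw [← pow_succ']; congr 1; omega
  have e2 : (2 : ℕ) ^ (m - h) = 2 * 2 ^ (m - 1 - h) := by rw [← pow_succ']; congr 1; omega
  have e3 : (2 : ℕ) ^ (m - 1 - h) < 2 ^ (m - 1) := Nat.pow_lt_pow_right (by norm_num) (by omega)
  have z1 : (2 : ℤ) ^ m = 2 * 2 ^ (m - 1) := by exact_mod_cast e1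
  have z2 : (2 : ℤ) ^ (m - h) = 2 * 2 ^ (m - 1 - h) := by exact_mod_cast e2
  have hlow : Nat.card {y : GaloisField 2 m → ZMod 2 // y ∈ dualCode m e ∧
      wt y = 2 ^ (m - 1) - 2 ^ (m - 1 - h)} = (2 ^ m - 1) * 2 ^ (2 * h) := by
    rw [card_dualCode_wt_eq hm0 hinj (t := 2 ^ (m - h)),
      card_signChar_mul_goldSum_eq_pow hm0 hg h1 h2 (Or.inl rfl)]
    rw [Nat.cast_sub e3.le]
    push_cast
    linarith
  have hwt : ∀ y ∈ dualCode m e, wt y ∈ ({0, 2 ^ (m - 1) - 2 ^ (m - 1 - h), 2 ^ (m - 1),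
      2 ^ (m - 1) + 2 ^ (m - 1 - h), 2 ^ m} : Set ℕ) := by
    intro y hy
    rw [dualCode_eq_range] at hy
    obtain ⟨⟨a, b, c⟩, rfl⟩ := hy
    have hw := goldWord_wt hm0 e (a, b, c)
    have hS : goldSum e a b ∈ ({0, 2 ^ (m - h), -2 ^ (m - h), 2 ^ m} : Set ℤ) := by
      by_cases ha : a = 0
      · subst ha
        rw [goldSum_zero_left, card_galoisField_two hm0]
        by_cases hb : b = 0 <;> simp [hb]
      · rcases goldSum_values hm0 hg h2 ha b with h | h | h <;> simp [h]
    simp only [Set.mem_insert_iff, Set.mem_singleton_iff] at hS ⊢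
    generalize wt (goldWord m e (a, b, c)) = w at hw ⊢
    zify [e3.le]
    rcases zmod_two_cases c with rfl | rfl <;> simp only [signChar_zero, signChar_one] at hw <;>
      omega
  refine ⟨?_, ?_, ?_, hlow, ?_, ?_, hwt, ?_, ?_⟩
  · rw [dualCode_eq_range, LinearMap.finrank_range_of_inj hinj, Module.finrank_prod,
      Module.finrank_prod, GaloisField.finrank 2 hm0, Module.finrank_self]
    ring
  · rw [card_dualCode_wt_eq hm0 hinj (t := 2 ^ m) (by simp),
      card_signChar_mul_goldSum_eq_card hm0 hg h1 h2 (Or.inl rfl)]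
  · rw [card_dualCode_wt_eq hm0 hinj (t := -2 ^ m) (by push_cast; ring),
      card_signChar_mul_goldSum_eq_card hm0 hg h1 h2 (Or.inr rfl)]
  · rw [card_dualCode_wt_eq hm0 hinj (t := -2 ^ (m - h)) (by push_cast; linarith),
      card_signChar_mul_goldSum_eq_pow hm0 hg h1 h2 (Or.inr rfl)]
  · rw [card_dualCode_wt_eq hm0 hinj (t := 0) (by push_cast; linarith),
      card_signChar_mul_goldSum_eq_zero hm0 hg h2]
  · have hpos : 0 < (2 ^ m - 1) * 2 ^ (2 * h) :=
      Nat.mul_pos (Nat.sub_pos_of_lt (Nat.one_lt_two_pow hm0)) (by positivity)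
    rw [← hlow] at hpos
    obtain ⟨y, hy, hw⟩ := (Nat.card_pos_iff.mp hpos).1
    refine ⟨y, hy, ?_, hw⟩
    rintro rfl
    simp only [wt, Pi.zero_apply, ne_eq, not_true_eq_false, Finset.filter_false,
      Finset.card_empty] at hw
    omega
  · rintro w ⟨y, hy, hy0, rfl⟩
    have h0 : wt y ≠ 0 := by
      intro hw
      apply hy0
      ext g
      have := Finset.filter_eq_empty_iff.mp (Finset.card_eq_zero.mp hw) (Finset.mem_univ g)
      simpa using this
    have := hwt y hy
    simp only [Set.mem_insert_iff, Set.mem_singleton_iff] at this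
    omega
end

section
/- Let m ≥ 4 and let e be an integer with 1 ≤ e ≤ m/2. Consider the nonempty finite subsets B of F = GF(2^m) with |B| even, ∑_{g∈B} g = 0 and ∑_{g∈B} g^{2^e+1} = 0. The minimum possible value of |B| over all such B equals 6 if gcd(e,m) = 1, and equals 4 if gcd(e,m) > 1. (That is, the extended code C̄_e has minimum distance 6 if gcd(e,m)=1 and 4 otherwise.) -/
/-- A finite field with `2 ^ m` elements has characteristic two. -/
theorem charP_two_of_card_eq_two_pow {F : Type*} [Field F] [Fintype F] {m : ℕ}
    (hF : Fintype.card F = 2 ^ m) : CharP F 2 := by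
  have h : ((2 ^ m : ℕ) : F) = 0 := by rw [← hF]; exact Nat.cast_card_eq_zero F
  push_cast at h
  exact CharTwo.of_one_ne_zero_of_two_eq_zero one_ne_zero (eq_zero_of_pow_eq_zero h)

/-- The second derivative of `x ↦ x ^ (2 ^ e + 1)` in characteristic two. -/
theorem add_add_add_pow_two_pow_add_one {F : Type*} [Field F] [CharP F 2] (e : ℕ) (a b c : F) :
    a ^ (2 ^ e + 1) + b ^ (2 ^ e + 1) + c ^ (2 ^ e + 1) + (a + b + c) ^ (2 ^ e + 1) =
      (a + b) * (a + c) ^ 2 ^ e + (a + b) ^ 2 ^ e * (a + c) := by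
  have h2 : (2 : F) = 0 := CharTwo.two_eq_zero
  simp only [pow_succ _ (2 ^ e), add_pow_char_pow]
  linear_combination (b ^ 2 ^ e * b + c ^ 2 ^ e * c) * h2

theorem eq_one_of_pow_two_pow_eq_self {F : Type*} [Field F] [Fintype F] {m e : ℕ}
    (hF : Fintype.card F = 2 ^ m) (hgcd : Nat.gcd e m = 1) {t : F} (ht : t ≠ 0)
    (hte : t ^ 2 ^ e = t) : t = 1 := by
  have h1 : t ^ (2 ^ e - 1) = 1 := by
    apply mul_right_cancel₀ ht
    rw [← pow_succ, Nat.sub_add_cancel Nat.one_le_two_pow, hte, one_mul]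
  have h2 : t ^ (2 ^ m - 1) = 1 := hF ▸ FiniteField.pow_card_sub_one_eq_one t ht
  have h3 := Nat.dvd_gcd (orderOf_dvd_of_pow_eq_one h1) (orderOf_dvd_of_pow_eq_one h2)
  rw [Nat.pow_sub_one_gcd_pow_sub_one, hgcd] at h3
  exact orderOf_eq_one_iff.1 (Nat.dvd_one.1 (by simpa using h3))

theorem exists_pow_two_pow_eq_self {F : Type*} [Field F] [Fintype F] {m e : ℕ}
    (hF : Fintype.card F = 2 ^ m) (hgcd : 1 < Nat.gcd e m) :
    ∃ t : F, t ≠ 0 ∧ t ≠ 1 ∧ t ^ 2 ^ e = t := by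
  classical
  have hd : 2 ^ 2 ≤ 2 ^ Nat.gcd e m := Nat.pow_le_pow_right two_pos hgcd
  obtain ⟨p, hp, hpd⟩ := Nat.exists_prime_and_dvd (n := 2 ^ Nat.gcd e m - 1) (by omega)
  rw [← Nat.pow_sub_one_gcd_pow_sub_one] at hpd
  have : Fact p.Prime := ⟨hp⟩
  obtain ⟨u, hu⟩ := exists_prime_orderOf_dvd_card (G := Fˣ) p
    (by rw [Fintype.card_units, hF]; exact hpd.trans (Nat.gcd_dvd_right _ _))
  refine ⟨u, u.ne_zero, fun h => ?_, ?_⟩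
  · rw [Units.val_eq_one.1 h, orderOf_one] at hu
    exact hp.one_lt.ne hu
  · have h1 : u ^ (2 ^ e - 1) = 1 :=
      orderOf_dvd_iff_pow_eq_one.1 (hu ▸ hpd.trans (Nat.gcd_dvd_left _ _))
    rw [← Units.val_pow_eq_pow_val, ← Nat.sub_add_cancel (Nat.one_le_two_pow (n := e)), pow_succ,
      h1, one_mul]

theorem card_ne_two_of_sum_eq_zero {F : Type*} [Field F] [CharP F 2] {B : Finset F}
    (h : ∑ g ∈ B, g = 0) : B.card ≠ 2 := by
  classical
  intro hB
  obtain ⟨a, b, hab, rfl⟩ := Finset.card_eq_two.1 hB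
  rw [Finset.sum_pair hab] at h
  exact hab (CharTwo.add_eq_zero.1 h)

theorem card_ne_four_of_sum_eq_zero {F : Type*} [Field F] [Fintype F] [CharP F 2] {m e : ℕ}
    (hF : Fintype.card F = 2 ^ m) (hgcd : Nat.gcd e m = 1) {B : Finset F}
    (h : ∑ g ∈ B, g = 0) (h' : ∑ g ∈ B, g ^ (2 ^ e + 1) = 0) : B.card ≠ 4 := by
  classical
  intro hB
  obtain ⟨d, S, hd, rfl, hS⟩ := Finset.card_eq_succ.1 hB
  obtain ⟨a, b, c, hab, hac, hbc, rfl⟩ := Finset.card_eq_three.1 hS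
  rw [Finset.sum_insert hd, Finset.sum_insert (by simp [hab, hac]), Finset.sum_pair hbc] at h h'
  obtain rfl : d = a + b + c := by
    rw [CharTwo.add_eq_zero.1 h, add_assoc]
  have hx : a + b ≠ 0 := fun h => hab (CharTwo.add_eq_zero.1 h)
  have hy : a + c ≠ 0 := fun h => hac (CharTwo.add_eq_zero.1 h)
  have key := add_add_add_pow_two_pow_add_one e a b c
  have hz : (a + b) * (a + c) ^ 2 ^ e = (a + b) ^ 2 ^ e * (a + c) := by
    apply CharTwo.add_eq_zero.1
    rw [← key, ← h']
    ring
  have ht := eq_one_of_pow_two_pow_eq_self hF hgcd (div_ne_zero hx hy) (by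
    rw [div_pow, div_eq_div_iff (pow_ne_zero _ hy) hy, hz])
  rw [div_eq_one_iff_eq hy] at ht
  exact hbc (add_left_cancel ht)

/-- By pigeonhole, two distinct triples have the same power sums; in characteristic two their
symmetric difference has vanishing power sums. -/
theorem exists_card_le_six_sum_eq_zero {F : Type*} [Field F] [Fintype F] [CharP F 2]
    (hF : 9 ≤ Fintype.card F) (k : ℕ) :
    ∃ B : Finset F, B.Nonempty ∧ Even B.card ∧ B.card ≤ 6 ∧
      ∑ g ∈ B, g = 0 ∧ ∑ g ∈ B, g ^ k = 0 := by
  classical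
  have hlt : (Finset.univ : Finset (F × F)).card <
      (Finset.powersetCard 3 (Finset.univ : Finset F)).card := by
    rw [Finset.card_powersetCard, Finset.card_univ, Finset.card_univ, Fintype.card_prod]
    obtain ⟨n, hn⟩ := Nat.exists_eq_add_of_le' hF
    have h6 := Nat.descFactorial_eq_factorial_mul_choose (n + 9) 3
    simp only [Nat.descFactorial_succ, Nat.descFactorial_zero, Nat.factorial] at h6
    rw [hn]
    have e1 : n + 9 - 2 = n + 7 := by omega
    have e2 : n + 9 - 1 = n + 8 := by omega
    rw [e1, e2] at h6
    norm_num at h6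
    nlinarith
  obtain ⟨S, hS, T, hT, hne, hST⟩ := Finset.exists_ne_map_eq_of_card_lt_of_maps_to hlt
    (f := fun S : Finset F => (∑ g ∈ S, g, ∑ g ∈ S, g ^ k)) (fun _ _ => Finset.mem_univ _)
  rw [Finset.mem_powersetCard] at hS hT
  obtain ⟨h1, h2⟩ := Prod.ext_iff.1 hST
  have hdisj : Disjoint (S \ T) (T \ S) := disjoint_sdiff_sdiff
  have hsum (f : F → F) (h : ∑ g ∈ S, f g = ∑ g ∈ T, f g) :
      ∑ g ∈ (S \ T) ∪ (T \ S), f g = 0 := by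
    rw [Finset.sum_union hdisj, CharTwo.add_eq_zero]
    exact Finset.sum_sdiff_eq_sum_sdiff_iff.2 h
  have hcard : (S \ T).card = (T \ S).card := Finset.card_sdiff_comm (hS.2.trans hT.2.symm)
  refine ⟨(S \ T) ∪ (T \ S), ?_, ?_, ?_, hsum _ h1, hsum _ h2⟩
  · rw [Finset.nonempty_iff_ne_empty]
    intro h
    rw [Finset.union_eq_empty, Finset.sdiff_eq_empty_iff_subset,
      Finset.sdiff_eq_empty_iff_subset] at h
    exact hne (h.1.antisymm h.2)
  · rw [Finset.card_union_of_disjoint hdisj, hcard]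
    exact ⟨_, rfl⟩
  · rw [Finset.card_union_of_disjoint hdisj, ← hcard]
    have := Finset.card_le_card (Finset.sdiff_subset (s := S) (t := T))
    omega

theorem exists_card_eq_four_sum_eq_zero {F : Type*} [Field F] [Fintype F] [CharP F 2] {m e : ℕ}
    (hF : Fintype.card F = 2 ^ m) (hgcd : 1 < Nat.gcd e m) :
    ∃ B : Finset F, B.card = 4 ∧ ∑ g ∈ B, g = 0 ∧ ∑ g ∈ B, g ^ (2 ^ e + 1) = 0 := by
  classical
  obtain ⟨t, ht0, ht1, hte⟩ := exists_pow_two_pow_eq_self hF hgcd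
  have ht1' : 1 + t ≠ 0 := fun h => ht1 (CharTwo.add_eq_zero.1 h).symm
  have hmem0 : (0 : F) ∉ ({1, t, 1 + t} : Finset F) := by
    simp [ht0.symm, ht1'.symm]
  have hmem1 : (1 : F) ∉ ({t, 1 + t} : Finset F) := by
    simp [ht0, ht1.symm]
  have hmemt : t ≠ 1 + t := by simp
  refine ⟨{0, 1, t, 1 + t}, ?_, ?_, ?_⟩
  · rw [Finset.card_insert_of_notMem hmem0, Finset.card_insert_of_notMem hmem1,
      Finset.card_pair hmemt]
  · rw [Finset.sum_insert hmem0, Finset.sum_insert hmem1, Finset.sum_pair hmemt, zero_add,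
      ← add_assoc, CharTwo.add_self_eq_zero]
  · rw [Finset.sum_insert hmem0, Finset.sum_insert hmem1, Finset.sum_pair hmemt]
    have key := add_add_add_pow_two_pow_add_one e 0 1 t
    simp only [zero_add, one_pow, hte, one_mul, CharTwo.add_self_eq_zero] at key
    rw [one_pow, ← add_assoc, ← add_assoc, key]


/-- The minimum cardinality of a nonempty subset `B` of `F = GF(2^m)` with `|B|` even,
`∑_{g∈B} g = 0` and `∑_{g∈B} g^{2^e+1} = 0` is `6` if `gcd(e,m) = 1` and `4` if
`gcd(e,m) > 1`; i.e. the extended code `C̄_e` has minimum distance `6` or `4`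
accordingly. -/
theorem min_distance_extended_code (m : ℕ) (hm : 4 ≤ m)
    (e : ℕ) (he1 : 1 ≤ e) (hem : 2 * e ≤ m)
    (F : Type) [Field F] [Fintype F] (hF : Fintype.card F = 2 ^ m) :
    IsLeast {n : ℕ | ∃ B : Finset F, B.Nonempty ∧ B.card = n ∧ Even B.card ∧
        (∑ g ∈ B, g = 0) ∧ (∑ g ∈ B, g ^ (2 ^ e + 1) = 0)}
      (if Nat.gcd e m = 1 then 6 else 4) := by
  have : CharP F 2 := charP_two_of_card_eq_two_pow hF
  split_ifs with hgcd
  · have lower : ∀ B : Finset F, B.Nonempty → Even B.card → ∑ g ∈ B, g = 0 →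
        ∑ g ∈ B, g ^ (2 ^ e + 1) = 0 → 6 ≤ B.card := by
      intro B hne heven h1 h2
      have := hne.card_pos
      have := card_ne_two_of_sum_eq_zero h1
      have := card_ne_four_of_sum_eq_zero hF hgcd h1 h2
      obtain ⟨k, hk⟩ := heven
      omega
    constructor
    · have h16 : 2 ^ 4 ≤ 2 ^ m := Nat.pow_le_pow_right two_pos hm
      obtain ⟨B, hne, heven, hle, h1, h2⟩ :=
        exists_card_le_six_sum_eq_zero (F := F) (by omega) (2 ^ e + 1)
      exact ⟨B, hne, le_antisymm hle (lower B hne heven h1 h2), heven, h1, h2⟩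
    · rintro _ ⟨B, hne, rfl, heven, h1, h2⟩
      exact lower B hne heven h1 h2
  · constructor
    · have hpos : 0 < Nat.gcd e m := Nat.gcd_pos_of_pos_left _ he1
      obtain ⟨B, hB, h1, h2⟩ := exists_card_eq_four_sum_eq_zero hF (e := e) (by omega)
      exact ⟨B, Finset.card_pos.1 (by omega), hB, hB ▸ ⟨2, rfl⟩, h1, h2⟩
    · rintro _ ⟨B, hne, rfl, ⟨k, hk⟩, h1, -⟩
      have := hne.card_pos
      have := card_ne_two_of_sum_eq_zero h1
      omega
end
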